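/- Let A ∈ 𝒜 and f ∈ S_A (i.e., f = g·1_A for some g ∈ S). Let 𝒫 be any family of pairwise disjoint atoms or rings. Then the number of sets R ∈ 𝒫 with E_p(f,R) ≠ 0 is at most 1. -/

import Mathlib

open MeasureTheory ENNReal Set Filter
open scoped ENNReal NNReal Classical

noncomputable section

variable {Ω : Type} [MeasurableSpace Ω]

/-- The data of a filtration on `Ω`, recorded through the (finitely many) atoms of each
σ-algebra `ℱ_n`. -/
structure FiltrationAtoms (Ω : Type) [MeasurableSpace Ω] (μ : Measure Ω) where
  atoms : ℕ → Set (Set Ω)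
  atoms_finite : ∀ n, (atoms n).Finite
  atoms_measurable : ∀ n, ∀ A ∈ atoms n, MeasurableSet A
  atoms_zero : atoms 0 = {Set.univ}
  atoms_disjoint : ∀ n, (atoms n).Pairwise Disjoint
  atoms_cover : ∀ n, ⋃₀ atoms n = Set.univ
  atoms_pos : ∀ n, ∀ A ∈ atoms n, 0 < μ A
  atoms_refine : ∀ n, ∀ B ∈ atoms (n + 1), ∃ A ∈ atoms n, B ⊆ A

namespace FiltrationAtoms

variable {μ : Measure Ω}

/-- The collection `𝒜` of all atoms of the filtration. -/
def Atoms (F : FiltrationAtoms Ω μ) : Set (Set Ω) := ⋃ n, F.atoms n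

/-- A `ν`-ary filtration: every atom of `ℱ_n` is the union of at most `ν` atoms of `ℱ_{n+1}`. -/
def IsNuAry (F : FiltrationAtoms Ω μ) (ν : ℕ) : Prop :=
  ∀ n, ∀ A ∈ F.atoms n, ∃ T : Finset (Set Ω),
    T.card ≤ ν ∧ ↑T ⊆ F.atoms (n + 1) ∧ A = ⋃₀ ↑T

/-- A binary filtration: in the passage from `ℱ_n` to `ℱ_{n+1}`, exactly one atom `A` is
subdivided into two atoms `A'`, `A''` of positive measure with `μ A' ≤ μ A''`. -/
def IsBinary (F : FiltrationAtoms Ω μ) : Prop :=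
  ∀ n, ∃ A ∈ F.atoms n, ∃ A' A'' : Set Ω, A' ∈ F.atoms (n + 1) ∧ A'' ∈ F.atoms (n + 1) ∧
    Disjoint A' A'' ∧ A = A' ∪ A'' ∧ μ A' ≤ μ A'' ∧ 0 < μ A' ∧
    F.atoms (n + 1) = insert A' (insert A'' (F.atoms n \ {A}))

/-- `B` is one of the atoms into which the atom `A` is subdivided. -/
def IsChildOf (F : FiltrationAtoms Ω μ) (B A : Set Ω) : Prop :=
  ∃ n, A ∈ F.atoms n ∧ B ∈ F.atoms (n + 1) ∧ B ⊂ A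

/-- `R` is an atom or a (nonempty) ring, i.e. a difference `A \ B` of two nested atoms. -/
def IsAtomOrRing (F : FiltrationAtoms Ω μ) (R : Set Ω) : Prop :=
  R ∈ F.Atoms ∨ ∃ A ∈ F.Atoms, ∃ B ∈ F.Atoms, B ⊆ A ∧ R = A \ B ∧ R.Nonempty

end FiltrationAtoms

/-- The stability condition on the finite-dimensional space `S`:
there are `c₁, c₂ ∈ (0,1]` with `|{ω ∈ A : |f ω| ≥ c₁ ‖f‖_{L^∞(A)}}| ≥ c₂ |A|` for all
`f ∈ S` and all atoms `A`. -/
def StabilityCondition {μ : Measure Ω} (F : FiltrationAtoms Ω μ)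
    (S : Submodule ℝ (Ω → ℝ)) : Prop :=
  ∃ c₁ ∈ Set.Ioc (0:ℝ) 1, ∃ c₂ ∈ Set.Ioc (0:ℝ) 1,
    ∀ A ∈ F.Atoms, ∀ f ∈ S,
      ENNReal.ofReal c₂ * μ A ≤
        μ {ω | ω ∈ A ∧
          ENNReal.ofReal c₁ * eLpNormEssSup f (μ.restrict A) ≤ ENNReal.ofReal |f ω|}

/-- `E_p(f,R)`: the error of best `L^p(R)`-approximation of `f` by elements of `S` (restricted
to `R`). -/
def Ep (S : Submodule ℝ (Ω → ℝ)) (p : ℝ) (μ : Measure Ω) (f : Ω → ℝ) (R : Set Ω) : ℝ≥0∞ :=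
  ⨅ g ∈ S, eLpNorm (f - g) (ENNReal.ofReal p) (μ.restrict R)

/-- The ring-variation seminorm `|f|_{V_{σ,p}}`: the supremum of
`(∑_{R ∈ P} E_p(f,R)^σ)^{1/σ}` over all finite collections `P` of pairwise disjoint atoms
or rings. -/
def varSeminorm {μ : Measure Ω} (F : FiltrationAtoms Ω μ)
    (S : Submodule ℝ (Ω → ℝ)) (σ p : ℝ) (f : Ω → ℝ) : ℝ≥0∞ :=
  ⨆ (P : Finset (Set Ω)) (_ : ∀ R ∈ P, F.IsAtomOrRing R)
    (_ : (↑P : Set (Set Ω)).Pairwise Disjoint),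
    (∑ R ∈ P, Ep S p μ f R ^ σ) ^ (1 / σ)

/-- The full variation norm `‖f‖_{V_{σ,p}} = ‖f‖_p + |f|_{V_{σ,p}}`. -/
def varNorm {μ : Measure Ω} (F : FiltrationAtoms Ω μ)
    (S : Submodule ℝ (Ω → ℝ)) (σ p : ℝ) (f : Ω → ℝ) : ℝ≥0∞ :=
  eLpNorm f (ENNReal.ofReal p) μ + varSeminorm F S σ p f

/-- The dictionary `𝒞 = {g·1_A : g ∈ S, A ∈ 𝒜}`. -/
def dictC {μ : Measure Ω} (F : FiltrationAtoms Ω μ) (S : Submodule ℝ (Ω → ℝ)) :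
    Set (Ω → ℝ) :=
  {h | ∃ g ∈ S, ∃ A ∈ F.Atoms, h = A.indicator g}

/-- `Σ_n^D`: linear combinations of at most `n` elements of the dictionary `D`. -/
def SigmaN (D : Set (Ω → ℝ)) (n : ℕ) : Set (Ω → ℝ) :=
  {h | ∃ c : Fin n → ℝ, ∃ x : Fin n → Ω → ℝ, (∀ j, x j ∈ D) ∧ h = ∑ j, c j • x j}

/-- `σ_n(f, D)`: the error of best `n`-term approximation in `L^p` with respect to the
dictionary `D`. -/
def bestApprox (D : Set (Ω → ℝ)) (p : ℝ) (μ : Measure Ω) (f : Ω → ℝ) (n : ℕ) : ℝ≥0∞ :=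
  ⨅ y ∈ SigmaN D n, eLpNorm (f - y) (ENNReal.ofReal p) μ

/-- The `ℓ^q` norm (`0 < q ≤ ∞`) of a sequence of extended nonnegative reals. -/
def lqNorm (q : ℝ≥0∞) (a : ℕ → ℝ≥0∞) : ℝ≥0∞ :=
  if q = ∞ then ⨆ n, a n else (∑' n, a n ^ q.toReal) ^ (1 / q.toReal)

/-- The quasi-norm of the approximation space `𝒜_q^α`:
`‖f‖_p + ‖(2^{nα} σ_{2^n}(f,D))_n‖_{ℓ^q}`. -/
def approxNorm (D : Set (Ω → ℝ)) (p : ℝ) (q : ℝ≥0∞) (α : ℝ) (μ : Measure Ω)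
    (f : Ω → ℝ) : ℝ≥0∞ :=
  eLpNorm f (ENNReal.ofReal p) μ +
    lqNorm q (fun n => (2 : ℝ≥0∞) ^ ((n : ℝ) * α) * bestApprox D p μ f (2 ^ n))

/-- Membership in `L^p(S)`, the `L^p`-closure of the span of the dictionary `𝒞`. -/
def MemLpS {μ : Measure Ω} (F : FiltrationAtoms Ω μ) (S : Submodule ℝ (Ω → ℝ)) (p : ℝ)
    (f : Ω → ℝ) : Prop :=
  AEMeasurable f μ ∧ eLpNorm f (ENNReal.ofReal p) μ ≠ ∞ ∧
    ∀ ε : ℝ≥0∞, 0 < ε → ∃ n, ∃ y ∈ SigmaN (dictC F S) n,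
      eLpNorm (f - y) (ENNReal.ofReal p) μ < ε

/-- Membership in the variation space `V_{σ,p}(S)`. -/
def MemVar {μ : Measure Ω} (F : FiltrationAtoms Ω μ) (S : Submodule ℝ (Ω → ℝ)) (σ p : ℝ)
    (f : Ω → ℝ) : Prop :=
  MemLpS F S p f ∧ varSeminorm F S σ p f ≠ ∞

/-- The K-functional `K(f, t, L^p, Y)` for a subset `Y` of functions with (quasi-)norm
`yNorm`. -/
def Kfun (p : ℝ) (μ : Measure Ω) (Y : Set (Ω → ℝ)) (yNorm : (Ω → ℝ) → ℝ≥0∞)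
    (f : Ω → ℝ) (t : ℝ≥0∞) : ℝ≥0∞ :=
  ⨅ g ∈ Y, eLpNorm (f - g) (ENNReal.ofReal p) μ + t * yNorm g

/-- The quasi-norm of the real interpolation space `(L^p, Y)_{θ,q}`, namely
`‖(2^{nθ} K(f, 2^{-n}))_n‖_{ℓ^q}`. -/
def interpNorm (p : ℝ) (μ : Measure Ω) (Y : Set (Ω → ℝ)) (yNorm : (Ω → ℝ) → ℝ≥0∞)
    (θ : ℝ) (q : ℝ≥0∞) (f : Ω → ℝ) : ℝ≥0∞ :=
  lqNorm q (fun n => (2 : ℝ≥0∞) ^ ((n : ℝ) * θ) *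
    Kfun p μ Y yNorm f ((2 : ℝ≥0∞) ^ (-(n : ℝ))))

/-- The modulus of smoothness `𝒲_S(f,t)_{σ,p}`; the supremum ranges over all finite
partitions of `Ω` into pairwise disjoint atoms or rings. -/
def modW {μ : Measure Ω} (F : FiltrationAtoms Ω μ) (S : Submodule ℝ (Ω → ℝ)) (σ p : ℝ)
    (f : Ω → ℝ) (t : ℝ) : ℝ≥0∞ :=
  ⨆ (P : Finset (Set Ω)) (_ : ∀ R ∈ P, F.IsAtomOrRing R)
    (_ : (↑P : Set (Set Ω)).Pairwise Disjoint) (_ : ⋃₀ (↑P : Set (Set Ω)) = Set.univ),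
    min (ENNReal.ofReal t) ((P.card : ℝ≥0∞)⁻¹) ^ (1 / σ - 1 / p) *
      (∑ R ∈ P, Ep S p μ f R ^ σ) ^ (1 / σ)

/-- `h` belongs to `S(ℱ_n)`: on each atom of `ℱ_n`, `h` agrees with some element of `S`. -/
def PiecewiseS {μ : Measure Ω} (F : FiltrationAtoms Ω μ) (S : Submodule ℝ (Ω → ℝ)) (n : ℕ)
    (h : Ω → ℝ) : Prop :=
  ∀ A ∈ F.atoms n, ∃ g ∈ S, Set.EqOn h g A

/-- The near-best approximation operator `W_μ f = ∑_{A ∈ 𝒜_μ} f_A · 1_A` built from a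
selection `fA` of near-best approximants on atoms. -/
def Wop {μ : Measure Ω} (F : FiltrationAtoms Ω μ) (fA : (Ω → ℝ) → Set Ω → Ω → ℝ)
    (f : Ω → ℝ) (n : ℕ) : Ω → ℝ :=
  ∑ A ∈ (F.atoms_finite n).toFinset, A.indicator (fA f A)

end

namespace FiltrationAtoms

variable {Ω : Type} [MeasurableSpace Ω] {μ : Measure Ω}

lemma exists_superset_of_le (F : FiltrationAtoms Ω μ) {m n : ℕ} (h : m ≤ n) {B : Set Ω}
    (hB : B ∈ F.atoms n) : ∃ A ∈ F.atoms m, B ⊆ A := by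
  induction n, h using Nat.le_induction generalizing B with
  | base => exact ⟨B, hB, subset_rfl⟩
  | succ n _ ih =>
    obtain ⟨C, hC, hBC⟩ := F.atoms_refine n B hB
    obtain ⟨A, hA, hCA⟩ := ih hC
    exact ⟨A, hA, hBC.trans hCA⟩

lemma subset_or_disjoint_of_le (F : FiltrationAtoms Ω μ) {m n : ℕ} (h : m ≤ n) {A B : Set Ω}
    (hA : A ∈ F.atoms m) (hB : B ∈ F.atoms n) : B ⊆ A ∨ Disjoint B A := by
  obtain ⟨C, hC, hBC⟩ := F.exists_superset_of_le h hB
  by_cases hCA : C = A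
  · exact .inl (hCA ▸ hBC)
  · exact .inr ((F.atoms_disjoint m hC hA hCA).mono_left hBC)

/-- Any two atoms are nested or disjoint. -/
lemma subset_or_subset_or_disjoint (F : FiltrationAtoms Ω μ) {A B : Set Ω}
    (hA : A ∈ F.Atoms) (hB : B ∈ F.Atoms) : A ⊆ B ∨ B ⊆ A ∨ Disjoint A B := by
  obtain ⟨m, hA⟩ := mem_iUnion.1 hA
  obtain ⟨n, hB⟩ := mem_iUnion.1 hB
  rcases le_total m n with h | h
  · exact .inr ((F.subset_or_disjoint_of_le h hA hB).imp_right fun h ↦ h.symm)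
  · rcases F.subset_or_disjoint_of_le h hB hA with h | h
    exacts [.inl h, .inr (.inr h)]

lemma measurableSet_of_mem_Atoms (F : FiltrationAtoms Ω μ) {A : Set Ω} (hA : A ∈ F.Atoms) :
    MeasurableSet A := by
  obtain ⟨n, hA⟩ := mem_iUnion.1 hA
  exact F.atoms_measurable n A hA

lemma IsAtomOrRing.measurableSet {F : FiltrationAtoms Ω μ} {R : Set Ω}
    (hR : F.IsAtomOrRing R) : MeasurableSet R := by
  rcases hR with hR | ⟨A, hA, B, hB, -, rfl, -⟩
  · exact F.measurableSet_of_mem_Atoms hR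
  · exact (F.measurableSet_of_mem_Atoms hA).diff (F.measurableSet_of_mem_Atoms hB)

/-- An atom or ring `R` that meets an atom `A` without being contained in it is of the form
`X \ B` with an atom `X ⊇ A`, where `B` is contained in `A` or disjoint from it. -/
lemma IsAtomOrRing.exists_eq_diff {F : FiltrationAtoms Ω μ} {R A : Set Ω}
    (hR : F.IsAtomOrRing R) (hA : A ∈ F.Atoms) (hmeet : ¬ Disjoint R A) (hsub : ¬ R ⊆ A) :
    ∃ X ∈ F.Atoms, ∃ B, A ⊆ X ∧ R = X \ B ∧ (B ⊆ A ∨ Disjoint B A) := by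
  rcases hR with hR | ⟨X, hX, B, hB, -, rfl, -⟩
  · refine ⟨R, hR, ∅, ?_, by simp, by simp⟩
    rcases F.subset_or_subset_or_disjoint hA hR with h | h | h
    exacts [h, absurd h hsub, absurd h.symm hmeet]
  · refine ⟨X, hX, B, ?_, rfl, ?_⟩
    · rcases F.subset_or_subset_or_disjoint hA hX with h | h | h
      exacts [h, absurd (sdiff_subset.trans h) hsub, absurd (h.symm.mono_left sdiff_subset) hmeet]
    · rcases F.subset_or_subset_or_disjoint hA hB with h | h | h
      exacts [absurd (disjoint_sdiff_left.mono_right h) hmeet, .inl h, .inr h.symm]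

/-- Two atoms or rings that meet an atom `A` without being contained in it are not disjoint. -/
lemma IsAtomOrRing.not_disjoint {F : FiltrationAtoms Ω μ} {R R' A : Set Ω}
    (hR : F.IsAtomOrRing R) (hR' : F.IsAtomOrRing R') (hA : A ∈ F.Atoms)
    (hmeet : ¬ Disjoint R A) (hsub : ¬ R ⊆ A) (hmeet' : ¬ Disjoint R' A) (hsub' : ¬ R' ⊆ A) :
    ¬ Disjoint R R' := by
  obtain ⟨X, hX, B, hAX, hRX, hB⟩ := hR.exists_eq_diff hA hmeet hsub
  obtain ⟨Y, hY, C, hAY, hRY, hC⟩ := hR'.exists_eq_diff hA hmeet' hsub'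
  have key : ∀ {P Q Z D : Set Ω}, P ⊆ Z → Q = Z \ D → (D ⊆ A ∨ Disjoint D A) →
      ¬ Disjoint P A → ¬ P ⊆ A → ¬ Disjoint P Q := by
    rintro P Q Z D hPZ rfl hD hPm hPs hdis
    have hPD : P ⊆ D := fun x hx ↦ by
      by_contra hxD
      exact disjoint_left.1 hdis hx ⟨hPZ hx, hxD⟩
    exact hD.elim (fun h ↦ hPs (hPD.trans h)) (fun h ↦ hPm (h.mono_left hPD))
  rcases F.subset_or_subset_or_disjoint hX hY with h | h | h
  · exact key ((hRX.trans_subset sdiff_subset).trans h) hRY hC hmeet hsub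
  · exact fun hd ↦ key ((hRY.trans_subset sdiff_subset).trans h) hRX hB hmeet' hsub' hd.symm
  · exact absurd ((h.mono_left hAX).mono_right hAY |> disjoint_self.1)
      fun hA0 ↦ hmeet (hA0 ▸ disjoint_bot_right)

end FiltrationAtoms

lemma Ep_eq_zero_of_eqOn {Ω : Type} [MeasurableSpace Ω] {μ : Measure Ω}
    {S : Submodule ℝ (Ω → ℝ)} {p : ℝ} {f g : Ω → ℝ} {R : Set Ω} (hR : MeasurableSet R)
    (hg : g ∈ S) (hfg : EqOn f g R) : Ep S p μ f R = 0 := by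
  refine le_antisymm (iInf₂_le_of_le g hg (le_of_eq ?_)) bot_le
  have h : f - g =ᵐ[μ.restrict R] 0 := by
    filter_upwards [ae_restrict_mem hR] with x hx
    simp [hfg hx]
  rw [eLpNorm_congr_ae h, eLpNorm_zero]

/-- If `A ∈ 𝒜` and `f = g·1_A ∈ S_A`, then for every family `Pfam` of pairwise
disjoint atoms or rings, at most one `R ∈ Pfam` satisfies `E_p(f,R) ≠ 0`. -/
theorem statement3
    {Ω : Type} [MeasurableSpace Ω] {μ : Measure Ω} [IsProbabilityMeasure μ]
    (F : FiltrationAtoms Ω μ) (ν : ℕ) (hν : 2 ≤ ν) (hFν : F.IsNuAry ν)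
    (S : Submodule ℝ (Ω → ℝ)) (hSfin : Module.Finite ℝ S)
    (hSmeas : ∀ g ∈ S, Measurable g) (hSbdd : ∀ g ∈ S, eLpNormEssSup g μ ≠ ∞)
    (p : ℝ) (hp : 0 < p)
    (A : Set Ω) (hA : A ∈ F.Atoms) (g : Ω → ℝ) (hg : g ∈ S)
    (Pfam : Set (Set Ω)) (hPfam : ∀ R ∈ Pfam, F.IsAtomOrRing R)
    (hPfamdisj : Pfam.Pairwise Disjoint) :
    {R | R ∈ Pfam ∧ Ep S p μ (A.indicator g) R ≠ 0}.Subsingleton := by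
  have hbad : ∀ R ∈ Pfam, Ep S p μ (A.indicator g) R ≠ 0 → ¬ Disjoint R A ∧ ¬ R ⊆ A := by
    refine fun R hR hE ↦ ⟨fun h ↦ hE ?_, fun h ↦ hE ?_⟩
    · exact Ep_eq_zero_of_eqOn (hPfam R hR).measurableSet S.zero_mem
        fun x hx ↦ indicator_of_notMem (disjoint_left.1 h hx) g
    · exact Ep_eq_zero_of_eqOn (hPfam R hR).measurableSet hg
        fun x hx ↦ indicator_of_mem (h hx) g
  rintro R ⟨hR, hE⟩ R' ⟨hR', hE'⟩
  by_contra hne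
  obtain ⟨hm, hs⟩ := hbad R hR hE
  obtain ⟨hm', hs'⟩ := hbad R' hR' hE'
  exact (hPfam R hR).not_disjoint (hPfam R' hR') hA hm hs hm' hs' (hPfamdisj hR hR' hne)
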